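/- arXiv:2011.13701 — 11 statements merged into one kernel-verified Lean document; each statement's English description precedes it below -/
import Mathlib

section
/- For every natural number n and every real number t with t ≠ -1, one has ∑_{k=0}^{n} l(n,k) · t^k = (1/(t+1)) · ∑_{k=0}^{n} (1/(n-k+1)) · (t/(t+1))^k · (1 + t^{n-k+1}). -/
open Finset

/-- The Leibnitz numbers `l(n,k) = 1/((n+1) * C(n,k))`. -/
noncomputable def leibnitz (n k : ℕ) : ℝ := 1 / (((n : ℝ) + 1) * (n.choose k))

theorem leibnitz_zero_right (n : ℕ) : leibnitz n 0 = 1 / ((n : ℝ) + 1) := by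
  simp [leibnitz]

theorem leibnitz_self (n : ℕ) : leibnitz n n = 1 / ((n : ℝ) + 1) := by
  simp [leibnitz]

/-- The Pascal-type recurrence of the Leibnitz triangle. -/
theorem leibnitz_eq_add {n k : ℕ} (hk : k ≤ n) :
    leibnitz n k = leibnitz (n + 1) k + leibnitz (n + 1) (k + 1) := by
  obtain ⟨m, rfl⟩ := Nat.exists_eq_add_of_le hk
  have h₁ := Nat.choose_mul_succ_eq (k + m) k
  rw [show k + m + 1 - k = m + 1 by omega] at h₁
  have h₂ := Nat.add_one_mul_choose_eq (k + m) k
  have hc : ((k + m).choose k : ℝ) ≠ 0 := by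
    exact_mod_cast (Nat.choose_pos (by omega)).ne'
  have hs : (k + m + 1 : ℝ) ≠ 0 := by positivity
  have hs' : (k + m + 1 + 1 : ℝ) ≠ 0 := by positivity
  have hk' : (k + 1 : ℝ) ≠ 0 := by positivity
  have hm' : (m + 1 : ℝ) ≠ 0 := by positivity
  have e₁ : ((k + m + 1).choose k : ℝ) = (k + m).choose k * (k + m + 1) / (m + 1) := by
    rw [eq_div_iff hm']
    exact_mod_cast h₁.symm
  have e₂ : ((k + m + 1).choose (k + 1) : ℝ) =
      (k + m + 1) * (k + m).choose k / (k + 1) := by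
    rw [eq_div_iff hk']
    exact_mod_cast h₂.symm
  simp only [leibnitz, e₁, e₂]
  push_cast
  field_simp
  ring

/-- The recurrence satisfied by the row generating polynomials of the Leibnitz triangle. -/
theorem add_one_mul_sum_leibnitz (n : ℕ) (t : ℝ) :
    (t + 1) * ∑ k ∈ range (n + 2), leibnitz (n + 1) k * t ^ k =
      1 / ((n + 1 : ℕ) + 1 : ℝ) * (1 + t ^ (n + 2)) +
        t * ∑ k ∈ range (n + 1), leibnitz n k * t ^ k := by
  have h : t * ∑ k ∈ range (n + 1), leibnitz n k * t ^ k =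
      t * ∑ k ∈ range (n + 1), leibnitz (n + 1) k * t ^ k +
        ∑ k ∈ range (n + 1), leibnitz (n + 1) (k + 1) * t ^ (k + 1) := by
    rw [mul_sum, mul_sum, ← sum_add_distrib]
    refine sum_congr rfl fun k hk => ?_
    rw [leibnitz_eq_add (Nat.lt_succ_iff.mp (mem_range.mp hk))]
    ring
  have hl := sum_range_succ (fun k => leibnitz (n + 1) k * t ^ k) (n + 1)
  have hf := sum_range_succ' (fun k => leibnitz (n + 1) k * t ^ k) (n + 1)
  simp only [leibnitz_self, leibnitz_zero_right] at hl hf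
  linear_combination t * hl + hf - h

theorem stmt0 (n : ℕ) (t : ℝ) (ht : t ≠ -1) :
    ∑ k ∈ range (n + 1), leibnitz n k * t ^ k =
      (1 / (t + 1)) * ∑ k ∈ range (n + 1),
        (1 / ((n - k : ℕ) + 1 : ℝ)) * (t / (t + 1)) ^ k * (1 + t ^ (n - k + 1)) := by
  have ht' : t + 1 ≠ 0 := fun h => ht (eq_neg_of_add_eq_zero_left h)
  induction n with
  | zero => simp [leibnitz, add_comm 1 t, ht']
  | succ n ih =>
    apply mul_left_cancel₀ ht'
    rw [add_one_mul_sum_leibnitz, ih, sum_range_succ' _ (n + 1), ← mul_assoc (t + 1),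
      mul_one_div_cancel ht', one_mul, ← mul_assoc, mul_sum, add_comm]
    congr 1
    · refine sum_congr rfl fun k _ => ?_
      rw [Nat.add_sub_add_right, pow_succ (t / (t + 1))]
      ring
    · simp
end

section
/- For every natural number n, one has ∑_{k=0}^{n} l(n,k) = ∑_{k=0}^{n} 1/((n-k+1) · 2^k). -/
open Finset

theorem leibnitz_succ_add_leibnitz_succ_succ {n k : ℕ} (hk : k ≤ n) :
    leibnitz (n + 1) k + leibnitz (n + 1) (k + 1) = leibnitz n k := by
  have h₁ : (n.choose k : ℝ) * (n + 1) = (n + 1).choose k * (n + 1 - k) := by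
    have h := congrArg (Nat.cast (R := ℝ)) (Nat.choose_mul_succ_eq n k)
    rw [Nat.cast_mul, Nat.cast_mul, Nat.cast_sub (by omega)] at h
    exact_mod_cast h
  have h₂ : ((n : ℝ) + 1) * n.choose k = (n + 1).choose (k + 1) * (k + 1) := by
    exact_mod_cast Nat.add_one_mul_choose_eq n k
  have c₀ : (n.choose k : ℝ) ≠ 0 := by
    exact_mod_cast (Nat.choose_pos hk).ne'
  have c₁ : ((n + 1).choose k : ℝ) ≠ 0 := by
    exact_mod_cast (Nat.choose_pos (by omega : k ≤ n + 1)).ne'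
  have c₂ : ((n + 1).choose (k + 1) : ℝ) ≠ 0 := by
    exact_mod_cast (Nat.choose_pos (by omega : k + 1 ≤ n + 1)).ne'
  have hn₁ : (n : ℝ) + 1 ≠ 0 := by positivity
  have hn₂ : (n : ℝ) + 1 + 1 ≠ 0 := by positivity
  have e₁ : leibnitz (n + 1) k = (n + 1 - k) / ((n + 1 + 1) * ((n + 1) * n.choose k)) := by
    rw [leibnitz, div_eq_div_iff (by push_cast; positivity) (by positivity)]
    push_cast
    linear_combination ((n : ℝ) + 1 + 1) * h₁
  have e₂ : leibnitz (n + 1) (k + 1) = (k + 1) / ((n + 1 + 1) * ((n + 1) * n.choose k)) := by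
    rw [leibnitz, div_eq_div_iff (by push_cast; positivity) (by positivity)]
    push_cast
    linear_combination ((n : ℝ) + 1 + 1) * h₂
  rw [e₁, e₂, leibnitz]
  field_simp
  ring

theorem two_mul_sum_leibnitz_succ (n : ℕ) :
    2 * ∑ k ∈ range (n + 2), leibnitz (n + 1) k =
      ∑ k ∈ range (n + 1), leibnitz n k + 2 / ((n : ℝ) + 2) := by
  have h : ∑ k ∈ range (n + 1), leibnitz n k =
      ∑ k ∈ range (n + 1), leibnitz (n + 1) k +
        ∑ k ∈ range (n + 1), leibnitz (n + 1) (k + 1) := by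
    rw [← sum_add_distrib]
    exact sum_congr rfl fun k hk =>
      (leibnitz_succ_add_leibnitz_succ_succ (by simpa [Nat.lt_succ_iff] using hk)).symm
  have hl := sum_range_succ (leibnitz (n + 1)) (n + 1)
  have hr := sum_range_succ' (leibnitz (n + 1)) (n + 1)
  rw [leibnitz_self] at hl
  rw [leibnitz_zero_right] at hr
  push_cast at hl hr
  rw [show (n : ℝ) + 1 + 1 = n + 2 by ring] at hl hr
  linear_combination hl + hr - h

theorem stmt1 (n : ℕ) :
    ∑ k ∈ range (n + 1), leibnitz n k =
      ∑ k ∈ range (n + 1), 1 / ((((n - k : ℕ) : ℝ) + 1) * 2 ^ k) := by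
  induction n with
  | zero => simp [leibnitz]
  | succ n ih =>
    have h := two_mul_sum_leibnitz_succ n
    have hr : ∑ k ∈ range (n + 1), 1 / ((((n + 1 - (k + 1) : ℕ) : ℝ) + 1) * 2 ^ (k + 1)) =
        (∑ k ∈ range (n + 1), 1 / ((((n - k : ℕ) : ℝ) + 1) * 2 ^ k)) / 2 := by
      rw [sum_div]
      refine sum_congr rfl fun k _ => ?_
      rw [Nat.add_sub_add_right, pow_succ, ← mul_assoc, div_div]
    rw [sum_range_succ' (fun k => 1 / ((((n + 1 - k : ℕ) : ℝ) + 1) * 2 ^ k)), hr, ← ih]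
    simp only [Nat.sub_zero, pow_zero, mul_one]
    push_cast
    rw [show (n : ℝ) + 1 + 1 = n + 2 by ring]
    linear_combination h / 2
end

section
/- For every natural number n and every real number t with t ≠ -1, one has ∑_{k=0}^{n} l(n,k) · t^k = (1/(1+t)) · ∑_{j=0}^{n} (1/(j+1)) · (t/(1+t))^{n-j} · (1 + t^{j+1}). -/
open Finset

theorem one_add_mul_sum_leibnitz_succ (n : ℕ) (t : ℝ) :
    (1 + t) * ∑ k ∈ range (n + 1 + 1), leibnitz (n + 1) k * t ^ k =
      t * ∑ k ∈ range (n + 1), leibnitz n k * t ^ k +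
        1 / ((n : ℝ) + 1 + 1) * (1 + t ^ (n + 1 + 1)) := by
  have hsum : t * ∑ k ∈ range (n + 1), leibnitz n k * t ^ k =
      t * ∑ k ∈ range (n + 1), leibnitz (n + 1) k * t ^ k +
        ∑ k ∈ range (n + 1), leibnitz (n + 1) (k + 1) * t ^ (k + 1) := by
    rw [mul_sum, mul_sum, ← sum_add_distrib]
    refine sum_congr rfl fun k hk => ?_
    rw [← leibnitz_succ_add_leibnitz_succ_succ (Nat.lt_succ_iff.mp (mem_range.mp hk))]
    ring
  have hfirst := sum_range_succ' (fun k => leibnitz (n + 1) k * t ^ k) (n + 1)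
  have hlast := sum_range_succ (fun k => leibnitz (n + 1) k * t ^ k) (n + 1)
  simp only [leibnitz_zero_right, leibnitz_self, Nat.cast_add_one] at hfirst hlast
  linear_combination hfirst + t * hlast - hsum

theorem stmt3 (n : ℕ) (t : ℝ) (ht : t ≠ -1) :
    ∑ k ∈ range (n + 1), leibnitz n k * t ^ k =
      (1 / (1 + t)) * ∑ j ∈ range (n + 1),
        (1 / ((j : ℝ) + 1)) * (t / (1 + t)) ^ (n - j) * (1 + t ^ (j + 1)) := by
  have h : 1 + t ≠ 0 := fun h => ht (by linarith)
  induction n with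
  | zero => simp [leibnitz, h]
  | succ n ih =>
    have hsum : ∑ j ∈ range (n + 1),
        (1 / ((j : ℝ) + 1)) * (t / (1 + t)) ^ (n + 1 - j) * (1 + t ^ (j + 1)) =
        t / (1 + t) * ∑ j ∈ range (n + 1),
          (1 / ((j : ℝ) + 1)) * (t / (1 + t)) ^ (n - j) * (1 + t ^ (j + 1)) := by
      rw [mul_sum]
      refine sum_congr rfl fun j hj => ?_
      rw [Nat.succ_sub (Nat.lt_succ_iff.mp (mem_range.mp hj)), pow_succ]
      ring
    apply mul_left_cancel₀ h
    rw [one_add_mul_sum_leibnitz_succ, ih, sum_range_succ _ (n + 1), hsum, Nat.sub_self,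
      pow_zero, Nat.cast_add_one]
    field_simp
end

section
/- For every natural number n, one has ∑_{k=0}^{n} 1/((n+1) · C(n,k)) = ∑_{j=0}^{n} 2^{j-n} / (j+1), where 2^{j-n} denotes the real power (1/2)^{n-j}. -/
open Finset

/-- The Leibniz harmonic triangle: each entry is the sum of the two entries below it. -/
theorem leibniz_triangle_add {n k : ℕ} (hk : k ≤ n) :
    1 / (((n + 1 : ℕ) + 1 : ℝ) * ((n + 1).choose k)) +
        1 / (((n + 1 : ℕ) + 1 : ℝ) * ((n + 1).choose (k + 1))) =
      1 / (((n : ℝ) + 1) * (n.choose k)) := by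
  have hc : (0 : ℝ) < n.choose k := mod_cast Nat.choose_pos hk
  have hd : (0 : ℝ) < (n + 1).choose k := mod_cast Nat.choose_pos (by lia)
  have he : (0 : ℝ) < (n + 1).choose (k + 1) := mod_cast Nat.choose_pos (by lia)
  have h₁ : (n.choose k : ℝ) * (n + 1) = (n + 1).choose k * (n + 1 - k) := by
    have h := congrArg (Nat.cast (R := ℝ)) (Nat.choose_mul_succ_eq n k)
    rw [Nat.cast_mul, Nat.cast_mul, Nat.cast_sub (by lia)] at h
    exact_mod_cast h
  have h₂ : ((n : ℝ) + 1) * n.choose k = (n + 1).choose (k + 1) * (k + 1) :=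
    mod_cast Nat.add_one_mul_choose_eq n k
  have e₁ : 1 / ((n + 1).choose k : ℝ) = (n + 1 - k) / ((n + 1) * n.choose k) := by
    rw [div_eq_div_iff (by positivity) (by positivity)]
    linarith
  have e₂ : 1 / ((n + 1).choose (k + 1) : ℝ) = (k + 1) / ((n + 1) * n.choose k) := by
    rw [div_eq_div_iff (by positivity) (by positivity)]
    linarith
  rw [← one_div_mul_one_div, ← one_div_mul_one_div, e₁, e₂]
  push_cast
  field_simp
  ring

theorem stmt4 (n : ℕ) :
    ∑ k ∈ range (n + 1), 1 / (((n : ℝ) + 1) * (n.choose k)) =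
      ∑ j ∈ range (n + 1), (1 / 2 : ℝ) ^ (n - j) / ((j : ℝ) + 1) := by
  induction n with
  | zero => simp
  | succ n ih =>
    have hl : ∑ k ∈ range (n + 1), 1 / (((n : ℝ) + 1) * (n.choose k)) =
        ∑ k ∈ range (n + 1), 1 / (((n + 1 : ℕ) + 1 : ℝ) * ((n + 1).choose k)) +
        ∑ k ∈ range (n + 1), 1 / (((n + 1 : ℕ) + 1 : ℝ) * ((n + 1).choose (k + 1))) := by
      rw [← sum_add_distrib]
      exact sum_congr rfl fun k hk ↦ (leibniz_triangle_add (mem_range_succ_iff.mp hk)).symm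
    have hr : ∑ j ∈ range (n + 1), (1 / 2 : ℝ) ^ (n + 1 - j) / ((j : ℝ) + 1) =
        1 / 2 * ∑ j ∈ range (n + 1), (1 / 2 : ℝ) ^ (n - j) / ((j : ℝ) + 1) := by
      rw [mul_sum]
      refine sum_congr rfl fun j hj ↦ ?_
      rw [Nat.succ_sub (mem_range_succ_iff.mp hj), pow_succ]
      ring
    have hlast := sum_range_succ
      (fun k ↦ 1 / (((n + 1 : ℕ) + 1 : ℝ) * ((n + 1).choose k))) (n + 1)
    have hfirst := sum_range_succ'
      (fun k ↦ 1 / (((n + 1 : ℕ) + 1 : ℝ) * ((n + 1).choose k))) (n + 1)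
    simp only [Nat.choose_self, Nat.choose_zero_right, Nat.cast_one, mul_one] at hlast hfirst
    rw [sum_range_succ (fun j : ℕ ↦ (1 / 2 : ℝ) ^ (n + 1 - j) / ((j : ℝ) + 1)), hr, ← ih, hl,
      Nat.sub_self, pow_zero]
    linarith
end

section
/- For every natural number n, one has ∑_{k=0}^{n} 1/((n+1) · C(n,k)) = - ∑_{j=0}^{n} Y_{n-j}(-1) / ((j+1) · (n-j)!). -/
open Finset

/-- The numbers `Y_n(λ) = (-1)^n * (2 * n! / (λ - 1)) * (λ^2 / (λ - 1))^n`. -/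
noncomputable def Ynum (n : ℕ) (lam : ℝ) : ℝ :=
  (-1) ^ n * (2 * (n.factorial : ℝ) / (lam - 1)) * (lam ^ 2 / (lam - 1)) ^ n

theorem Ynum_neg_one (n : ℕ) : Ynum n (-1) = -((n.factorial : ℝ) / 2 ^ n) := by
  have h : ((-1 : ℝ)) ^ n * (-1 / 2) ^ n = (1 / 2) ^ n := by
    rw [← mul_pow]; norm_num
  calc Ynum n (-1) = -(n.factorial : ℝ) * ((-1) ^ n * (-1 / 2) ^ n) := by
        unfold Ynum; norm_num; ring
    _ = _ := by rw [h, one_div, inv_pow]; ring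

/-- The recurrence of Leibniz's harmonic triangle. -/
theorem one_div_succ_mul_choose {n k : ℕ} (hk : k ≤ n) :
    1 / (((n : ℝ) + 1) * n.choose k) =
      1 / (((n : ℝ) + 2) * (n + 1).choose k) +
        1 / (((n : ℝ) + 2) * (n + 1).choose (k + 1)) := by
  have h₁ : ((n : ℝ) + 1) * n.choose k = (n + 1).choose (k + 1) * (k + 1) := by
    exact_mod_cast Nat.add_one_mul_choose_eq n k
  have h₂ : (n.choose k : ℝ) * (n + 1) = (n + 1).choose k * (n + 1 - k) := by
    have := Nat.choose_mul_succ_eq n k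
    rw [← @Nat.cast_inj ℝ] at this
    push_cast [Nat.cast_sub (show k ≤ n + 1 by lia)] at this
    exact this
  have hc : (0 : ℝ) < n.choose k := by exact_mod_cast Nat.choose_pos hk
  have hc₁ : (0 : ℝ) < (n + 1).choose k := by exact_mod_cast Nat.choose_pos (by lia)
  have hc₂ : (0 : ℝ) < (n + 1).choose (k + 1) := by exact_mod_cast Nat.choose_pos (by lia)
  have e₁ : 1 / (((n : ℝ) + 2) * (n + 1).choose k) =
      (n + 1 - k) / ((n + 2) * ((n + 1) * n.choose k)) := by
    rw [div_eq_div_iff (by positivity) (by positivity)]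
    linear_combination ((n : ℝ) + 2) * h₂
  have e₂ : 1 / (((n : ℝ) + 2) * (n + 1).choose (k + 1)) =
      (k + 1) / ((n + 2) * ((n + 1) * n.choose k)) := by
    rw [div_eq_div_iff (by positivity) (by positivity)]
    linear_combination ((n : ℝ) + 2) * h₁
  rw [e₁, e₂]
  field_simp
  ring

theorem sum_one_div_mul_choose_succ (n : ℕ) :
    ∑ k ∈ range (n + 2), 1 / (((n : ℝ) + 2) * (n + 1).choose k) =
      (∑ k ∈ range (n + 1), 1 / (((n : ℝ) + 1) * n.choose k)) / 2 + 1 / (n + 2) := by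
  have h : ∑ k ∈ range (n + 1), 1 / (((n : ℝ) + 1) * n.choose k) =
      ∑ k ∈ range (n + 1), 1 / (((n : ℝ) + 2) * (n + 1).choose k) +
        ∑ k ∈ range (n + 1), 1 / (((n : ℝ) + 2) * (n + 1).choose (k + 1)) := by
    rw [← sum_add_distrib]
    exact sum_congr rfl fun k hk =>
      one_div_succ_mul_choose (Nat.lt_succ_iff.mp (mem_range.mp hk))
  have hl := sum_range_succ (fun k => 1 / (((n : ℝ) + 2) * (n + 1).choose k)) (n + 1)
  have hf := sum_range_succ' (fun k => 1 / (((n : ℝ) + 2) * (n + 1).choose k)) (n + 1)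
  simp only [Nat.choose_self, Nat.choose_zero_right, Nat.cast_one, mul_one] at hl hf
  linarith

theorem sum_one_div_mul_choose (n : ℕ) :
    ∑ k ∈ range (n + 1), 1 / (((n : ℝ) + 1) * n.choose k) =
      ∑ j ∈ range (n + 1), 1 / (((j : ℝ) + 1) * 2 ^ (n - j)) := by
  induction n with
  | zero => simp
  | succ n ih =>
    have h : ∑ j ∈ range (n + 1), 1 / (((j : ℝ) + 1) * 2 ^ (n + 1 - j)) =
        (∑ j ∈ range (n + 1), 1 / (((j : ℝ) + 1) * 2 ^ (n - j))) / 2 := by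
      rw [sum_div]
      refine sum_congr rfl fun j hj => ?_
      rw [Nat.succ_sub (Nat.lt_succ_iff.mp (mem_range.mp hj)), pow_succ, div_div, mul_assoc]
    have hn : ((n + 1 : ℕ) : ℝ) + 1 = n + 2 := by push_cast; ring
    rw [hn, sum_one_div_mul_choose_succ, sum_range_succ _ (n + 1), h, ← ih, hn]
    simp

theorem stmt6 (n : ℕ) :
    ∑ k ∈ range (n + 1), 1 / (((n : ℝ) + 1) * (n.choose k)) =
      -∑ j ∈ range (n + 1),
        Ynum (n - j) (-1) / (((j : ℝ) + 1) * ((n - j).factorial : ℝ)) := by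
  rw [sum_one_div_mul_choose, ← sum_neg_distrib]
  refine sum_congr rfl fun j _ => ?_
  have : ((n - j).factorial : ℝ) ≠ 0 := by positivity
  rw [Ynum_neg_one]
  field_simp
end

section
/- For all real numbers a, b and all natural numbers n and 0 ≤ k ≤ n, the generalized Leibnitz number satisfies L(n,k;a,b) = (b-a)^{n+1} · k! · (n-k)! / (n+1)!; equivalently, L(n,k;a,b) = (b-a)^{n+1} / ((n+1) · C(n,k)). -/
open Finset

/-- The generalized Leibnitz numbers `L(n,k;a,b)`. -/
noncomputable def genLeibnitz (n k : ℕ) (a b : ℝ) : ℝ :=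
  ∑ j ∈ range (k + 1), ∑ v ∈ range (n - k + 1),
    (-1) ^ (n - j - v) * (k.choose j : ℝ) * ((n - k).choose v : ℝ) *
      (a ^ (k - j) * b ^ (n + j - k + 1) - a ^ (n - v + 1) * b ^ v) /
        (((n + j - k - v : ℕ) : ℝ) + 1)

/-- The Beta integral over an arbitrary interval, for natural exponents. -/
theorem integral_sub_pow_mul_sub_pow (a b : ℝ) (k m : ℕ) :
    ∫ x in a..b, (x - a) ^ k * (b - x) ^ m =
      (b - a) ^ (k + m + 1) * (k.factorial : ℝ) * (m.factorial : ℝ) /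
        ((k + m + 1).factorial : ℝ) := by
  induction m generalizing k with
  | zero =>
    have h : ∫ x in a..b, (x - a) ^ k = (b - a) ^ (k + 1) / (k + 1) := by
      rw [intervalIntegral.integral_comp_sub_right (fun x => x ^ k) a, integral_pow]
      simp
    have hk : (k.factorial : ℝ) ≠ 0 := by positivity
    simp only [pow_zero, mul_one, add_zero, h, Nat.factorial_succ, Nat.factorial_zero]
    push_cast
    field_simp
  | succ m ih =>
    have hu (x : ℝ) : HasDerivAt (fun x => (b - x) ^ (m + 1))
        (-((m + 1 : ℝ) * (b - x) ^ m)) x := by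
      simpa using ((hasDerivAt_id x).const_sub b).fun_pow (m + 1)
    have hv (x : ℝ) : HasDerivAt (fun x => (x - a) ^ (k + 1) / (k + 1 : ℝ))
        ((x - a) ^ k) x := by
      have h := (((hasDerivAt_id x).sub_const a).fun_pow (k + 1)).div_const (k + 1 : ℝ)
      have hk : (k + 1 : ℝ) ≠ 0 := by positivity
      simpa [mul_div_cancel_left₀ _ hk] using h
    have parts := intervalIntegral.integral_mul_deriv_eq_deriv_mul
      (fun x _ => hu x) (fun x _ => hv x)
      (Continuous.intervalIntegrable (by fun_prop) a b)
      (Continuous.intervalIntegrable (by fun_prop) a b)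
    have hr : ∀ x : ℝ, -((m + 1 : ℝ) * (b - x) ^ m) * ((x - a) ^ (k + 1) / (k + 1 : ℝ)) =
        -((m + 1 : ℝ) / (k + 1)) * ((x - a) ^ (k + 1) * (b - x) ^ m) := fun x => by ring
    simp only [mul_comm ((_ : ℝ) ^ k)]
    rw [parts]
    simp only [hr, intervalIntegral.integral_const_mul, ih, sub_self, ne_eq,
      Nat.add_eq_zero_iff, one_ne_zero, and_false, not_false_eq_true, zero_pow, zero_mul,
      zero_div, mul_zero, zero_sub]
    rw [show k + 1 + m + 1 = k + (m + 1) + 1 by ring, Nat.factorial_succ k,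
      Nat.factorial_succ m]
    push_cast
    field_simp

/-- The generalized Leibnitz numbers as Beta integrals. -/
theorem genLeibnitz_eq_integral (a b : ℝ) (n k : ℕ) (hk : k ≤ n) :
    genLeibnitz n k a b = ∫ x in a..b, (x - a) ^ k * (b - x) ^ (n - k) := by
  have hexp (x : ℝ) : (x - a) ^ k * (b - x) ^ (n - k) =
      ∑ j ∈ range (k + 1), ∑ v ∈ range (n - k + 1),
        ((-a) ^ (k - j) * (k.choose j : ℝ) * (b ^ v * (-1) ^ (n - k - v) *
          ((n - k).choose v : ℝ))) * x ^ (j + (n - k - v)) := by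
    rw [sub_eq_add_neg x, sub_eq_add_neg b, add_pow, add_pow, sum_mul_sum]
    refine sum_congr rfl fun j _ => sum_congr rfl fun v _ => ?_
    rw [neg_pow x, pow_add]
    ring
  simp only [hexp]
  rw [intervalIntegral.integral_finsetSum fun _ _ =>
    Continuous.intervalIntegrable (by fun_prop) a b, genLeibnitz]
  refine sum_congr rfl fun j hj => ?_
  rw [intervalIntegral.integral_finsetSum fun _ _ =>
    Continuous.intervalIntegrable (by fun_prop) a b]
  refine sum_congr rfl fun v hv => ?_
  rw [intervalIntegral.integral_const_mul, integral_pow]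
  obtain ⟨p, rfl⟩ := Nat.exists_eq_add_of_le (mem_range_succ_iff.1 hj)
  obtain ⟨q, hq⟩ := Nat.exists_eq_add_of_le (mem_range_succ_iff.1 hv)
  obtain rfl : n = j + p + (v + q) := by omega
  rw [show j + p + (v + q) - j - v = p + q by omega,
    show j + p + (v + q) - (j + p) = v + q by omega, show j + p - j = p by omega,
    show j + p + (v + q) + j - (j + p) + 1 = v + (j + q + 1) by omega,
    show j + p + (v + q) - v + 1 = p + (j + q + 1) by omega,
    show j + p + (v + q) + j - (j + p) - v = j + q by omega,
    show v + q - v = q by omega, neg_pow a p]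
  ring

theorem stmt9 (a b : ℝ) (n k : ℕ) (hk : k ≤ n) :
    genLeibnitz n k a b =
      (b - a) ^ (n + 1) * (k.factorial : ℝ) * ((n - k).factorial : ℝ) /
        ((n + 1).factorial : ℝ) := by
  rw [genLeibnitz_eq_integral a b n k hk, integral_sub_pow_mul_sub_pow,
    Nat.add_sub_cancel' hk]
end

section
/- For all real numbers a < b and all natural numbers n and 0 ≤ k ≤ n, the generalized Leibnitz number has the integral representation L(n,k;a,b) = ∫_{a}^{b} (x-a)^k (b-x)^{n-k} dx. -/
open Finset

theorem sub_pow_mul_sub_pow_eq_sum (a b x : ℝ) (k m : ℕ) :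
    (x - a) ^ k * (b - x) ^ m =
      ∑ j ∈ range (k + 1), ∑ v ∈ range (m + 1),
        ((-1) ^ (k - j + (m - v)) * (k.choose j : ℝ) * (m.choose v : ℝ) *
          (a ^ (k - j) * b ^ v)) * x ^ (j + (m - v)) := by
  rw [sub_eq_add_neg x a, sub_eq_add_neg b x, add_pow, add_pow, sum_mul_sum]
  refine sum_congr rfl fun j _ => sum_congr rfl fun v _ => ?_
  rw [neg_pow a, neg_pow x, pow_add, pow_add]
  ring

theorem stmt10 (a b : ℝ) (hab : a < b) (n k : ℕ) (hk : k ≤ n) :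
    genLeibnitz n k a b = ∫ x in a..b, (x - a) ^ k * (b - x) ^ (n - k) := by
  obtain ⟨m, rfl⟩ := Nat.exists_eq_add_of_le hk
  simp_rw [genLeibnitz, Nat.add_sub_cancel_left, sub_pow_mul_sub_pow_eq_sum]
  rw [intervalIntegral.integral_finsetSum fun _ _ =>
    Continuous.intervalIntegrable (by fun_prop) _ _]
  refine sum_congr rfl fun j hj => ?_
  rw [intervalIntegral.integral_finsetSum fun _ _ =>
    Continuous.intervalIntegrable (by fun_prop) _ _]
  refine sum_congr rfl fun v hv => ?_
  rw [intervalIntegral.integral_const_mul, integral_pow]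
  obtain ⟨i, rfl⟩ := Nat.exists_eq_add_of_le (mem_range_succ_iff.mp hj)
  obtain ⟨w, rfl⟩ := Nat.exists_eq_add_of_le (mem_range_succ_iff.mp hv)
  rw [show j + i + (v + w) - j - v = i + w by lia,
    show j + i + (v + w) + j - (j + i) + 1 = j + v + w + 1 by lia,
    show j + i + (v + w) - v + 1 = j + i + w + 1 by lia,
    show j + i + (v + w) + j - (j + i) - v = j + w by lia,
    Nat.add_sub_cancel_left, Nat.add_sub_cancel_left]
  ring
end

section
/- For all natural numbers n and 0 ≤ k ≤ n, one has ∑_{v=0}^{n-k} (-1)^{n-k-v} · C(n-k,v) / (n-v+1) = 1/((n+1) · C(n,k)); that is, the generalized Leibnitz number L(n,k;0,1) equals the Leibnitz number l(n,k). -/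
open Finset

theorem sum_neg_one_pow_mul_choose_succ (f : ℕ → ℝ) (m : ℕ) :
    ∑ j ∈ range (m + 2), (-1) ^ j * ((m + 1).choose j : ℝ) * f j =
      ∑ j ∈ range (m + 1), (-1) ^ j * (m.choose j : ℝ) * f j -
        ∑ j ∈ range (m + 1), (-1) ^ j * (m.choose j : ℝ) * f (j + 1) := by
  have extend : ∑ j ∈ range (m + 1), (-1) ^ j * (m.choose j : ℝ) * f j =
      ∑ j ∈ range (m + 2), (-1) ^ j * (m.choose j : ℝ) * f j := by
    simp [sum_range_succ _ (m + 1)]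
  rw [extend, sum_range_succ', sum_range_succ' _ (m + 1), add_sub_right_comm,
    ← sum_sub_distrib]
  congr 1
  · refine sum_congr rfl fun j _ => ?_
    rw [Nat.choose_succ_succ]
    push_cast
    ring
  · simp

theorem sum_neg_one_pow_mul_choose_div (m k : ℕ) :
    ∑ j ∈ range (m + 1), (-1) ^ j * (m.choose j : ℝ) * (1 / ((k : ℝ) + j + 1)) =
      1 / (((k : ℝ) + m + 1) * ((k + m).choose k)) := by
  induction m generalizing k with
  | zero => simp
  | succ m ih =>
    have shift := ih (k + 1)
    rw [sum_neg_one_pow_mul_choose_succ (fun j => 1 / ((k : ℝ) + j + 1)), ih k]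
    have shifted : ∑ j ∈ range (m + 1),
        (-1) ^ j * (m.choose j : ℝ) * (1 / ((k : ℝ) + (j + 1 : ℕ) + 1)) =
          1 / (((k : ℝ) + m + 2) * ((k + m + 1).choose (k + 1))) := by
      rw [show k + m + 1 = k + 1 + m by ring,
        show (k : ℝ) + m + 2 = ((k + 1 : ℕ) : ℝ) + m + 1 by push_cast; ring, ← shift]
      refine sum_congr rfl fun j _ => ?_
      push_cast
      ring
    rw [shifted, ← add_assoc k m 1]
    have hc : ((k + m).choose k : ℝ) ≠ 0 := by
      exact_mod_cast (Nat.choose_pos (Nat.le_add_right k m)).ne'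
    have h1 : ((k + m + 1).choose (k + 1) : ℝ) =
        ((k : ℝ) + m + 1) * (k + m).choose k / (k + 1) := by
      rw [eq_div_iff (by positivity)]
      exact_mod_cast (Nat.add_one_mul_choose_eq (k + m) k).symm
    have h2 : ((k + m + 1).choose k : ℝ) =
        ((k : ℝ) + m + 1) * (k + m).choose k / (m + 1) := by
      rw [eq_div_iff (by positivity)]
      have h := Nat.choose_mul_succ_eq (k + m) k
      rw [show k + m + 1 - k = m + 1 by lia, mul_comm] at h
      exact_mod_cast h.symm
    have : (k : ℝ) + m + 1 ≠ 0 := by positivity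
    have : (k : ℝ) + m + 2 ≠ 0 := by positivity
    have : (k : ℝ) + 1 ≠ 0 := by positivity
    have : (m : ℝ) + 1 ≠ 0 := by positivity
    rw [h1, h2]
    push_cast
    rw [show (k : ℝ) + (m + 1) + 1 = k + m + 2 by ring]
    field_simp
    ring

theorem stmt11 (n k : ℕ) (hk : k ≤ n) :
    ∑ v ∈ range (n - k + 1),
        (-1) ^ (n - k - v) * ((n - k).choose v : ℝ) / (((n - v : ℕ) : ℝ) + 1) =
      1 / (((n : ℝ) + 1) * (n.choose k)) := by
  obtain ⟨m, rfl⟩ := Nat.exists_eq_add_of_le hk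
  rw [Nat.add_sub_cancel_left, Nat.cast_add, ← sum_neg_one_pow_mul_choose_div m k,
    ← sum_range_reflect]
  refine sum_congr rfl fun j hj => ?_
  have hjm : j ≤ m := Nat.lt_succ_iff.mp (mem_range.mp hj)
  rw [show m + 1 - 1 - j = m - j by lia, Nat.sub_sub_self hjm, Nat.choose_symm hjm,
    show k + m - (m - j) = k + j by lia, Nat.cast_add, mul_one_div]
end

section
/- For all natural numbers n and 0 ≤ k ≤ n, one has ∑_{v=0}^{k} (-1)^{k-v} · C(k,v) / (n-v+1) = 1/((n+1) · C(n,k)); that is, the Leibnitz number l(n,k) equals this alternating finite sum. -/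
open Finset

/-- The Pascal-type recurrence for the Leibniz harmonic triangle. -/
theorem leibniz_sub_leibniz (m k : ℕ) (hk : k ≤ m) :
    1 / (((m : ℝ) + 1) * (m.choose k)) - 1 / (((m + 1 : ℕ) + 1 : ℝ) * ((m + 1).choose k)) =
      1 / (((m + 1 : ℕ) + 1 : ℝ) * ((m + 1).choose (k + 1))) := by
  obtain ⟨d, rfl⟩ := Nat.exists_eq_add_of_le hk
  have hA : (((k + d).choose k : ℕ) : ℝ) ≠ 0 := by
    exact_mod_cast (Nat.choose_pos (Nat.le_add_right k d)).ne'
  have h1 : (((k + d + 1).choose (k + 1) : ℕ) : ℝ) =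
      ((k : ℝ) + d + 1) * (k + d).choose k / (k + 1) := by
    rw [eq_div_iff (by positivity)]
    exact_mod_cast (Nat.add_one_mul_choose_eq (k + d) k).symm
  have h2 : (((k + d + 1).choose k : ℕ) : ℝ) =
      ((k : ℝ) + d + 1) * (k + d).choose k / (d + 1) := by
    rw [eq_div_iff (by positivity)]
    have h := Nat.choose_mul_succ_eq (k + d) k
    rw [show k + d + 1 - k = d + 1 by omega] at h
    have h' : (((k + d).choose k : ℕ) : ℝ) * (k + d + 1) = (k + d + 1).choose k * (d + 1) := by
      exact_mod_cast h
    linarith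
  rw [h1, h2]
  push_cast
  have h3 : (k : ℝ) + d + 1 ≠ 0 := by positivity
  have h4 : (k : ℝ) + d + 1 + 1 ≠ 0 := by positivity
  field_simp
  ring

/-- Pascal's rule turns the alternating sum of row `k + 1` into a difference of two alternating
sums of row `k`. -/
theorem alternating_sum_choose_succ (f : ℕ → ℝ) (k : ℕ) :
    ∑ v ∈ range (k + 2), (-1) ^ (k + 1 - v) * ((k + 1).choose v : ℝ) / f v =
      ∑ v ∈ range (k + 1), (-1) ^ (k - v) * (k.choose v : ℝ) / f (v + 1) -
        ∑ v ∈ range (k + 1), (-1) ^ (k - v) * (k.choose v : ℝ) / f v := by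
  have h : ∑ v ∈ range (k + 1), (-1) ^ (k - v) * (k.choose v : ℝ) / f v =
      -∑ v ∈ range (k + 2), (-1) ^ (k + 1 - v) * (k.choose v : ℝ) / f v := by
    rw [sum_range_succ _ (k + 1), Nat.choose_succ_self, Nat.cast_zero, mul_zero, zero_div,
      add_zero, ← sum_neg_distrib]
    refine sum_congr rfl fun v hv => ?_
    rw [Nat.succ_sub (Nat.lt_succ_iff.mp (mem_range.mp hv)), pow_succ]
    ring
  rw [h, sub_neg_eq_add, sum_range_succ' _ (k + 1), sum_range_succ' _ (k + 1), ← add_assoc,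
    ← sum_add_distrib]
  congr 1
  · refine sum_congr rfl fun v _ => ?_
    rw [Nat.add_sub_add_right, Nat.choose_succ_succ]
    push_cast
    ring
  · simp

theorem stmt12 (n k : ℕ) (hk : k ≤ n) :
    ∑ v ∈ range (k + 1),
        (-1) ^ (k - v) * (k.choose v : ℝ) / (((n - v : ℕ) : ℝ) + 1) =
      1 / (((n : ℝ) + 1) * (n.choose k)) := by
  induction k generalizing n with
  | zero => simp
  | succ k ih =>
    obtain ⟨m, rfl⟩ : ∃ m, n = m + 1 := ⟨n - 1, by omega⟩
    have hm : k ≤ m := by omega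
    rw [alternating_sum_choose_succ (fun v => ((m + 1 - v : ℕ) : ℝ) + 1), ih (m + 1) (by omega)]
    simp only [Nat.add_sub_add_right]
    rw [ih m hm, leibniz_sub_leibniz m k hm]
end

section
/- For every natural number n and every real number t, one has ∑_{k=0}^{n} l(n,k) · t^k = (1/n!) · ∑_{k=0}^{n} ∑_{j=0}^{n-k} (-1)^j · C(n,k) · C(n-k,j) · C(k,j) · (j! · (n-j)! / (n-j+1)) · t^{n-k}. -/
open Finset

theorem fwdDiff_iter_natCast_choose_eq_zero {m r : ℕ} (h : m < r) :
    (fwdDiff 1)^[r] (fun x : ℕ ↦ (x.choose m : ℝ)) = 0 := by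
  induction r generalizing m with
  | zero => omega
  | succ r ih =>
    rw [Function.iterate_succ_apply]
    cases m with
    | zero =>
      have h0 : fwdDiff 1 (fun x : ℕ ↦ (x.choose 0 : ℝ)) = (0 : ℝ) • fun _ ↦ (0 : ℝ) := by
        ext x
        simp [fwdDiff]
      rw [h0, fwdDiff_iter_const_smul, zero_smul]
    | succ m =>
      have h1 : fwdDiff 1 (fun x : ℕ ↦ (x.choose (m + 1) : ℝ)) =
          fun x : ℕ ↦ (x.choose m : ℝ) := by
        ext x
        simp [fwdDiff, Nat.choose_succ_succ']
      rw [h1]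
      exact ih (by omega)

theorem fwdDiff_iter_one_div_add_one (r p : ℕ) :
    (fwdDiff 1)^[r] (fun x : ℕ ↦ 1 / ((x : ℝ) + 1)) p =
      (-1) ^ r * (r.factorial * p.factorial / (p + r + 1).factorial) := by
  induction r generalizing p with
  | zero =>
    have := Nat.cast_ne_zero (R := ℝ).2 p.factorial_ne_zero
    have h : (p : ℝ) + 1 ≠ 0 := by positivity
    simp [Nat.factorial_succ]
    field_simp
  | succ r ih =>
    rw [Function.iterate_succ_apply', fwdDiff, ih, ih]
    have e1 : p + 1 + r + 1 = (p + r + 1) + 1 := by ring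
    have e2 : p + (r + 1) + 1 = (p + r + 1) + 1 := by ring
    rw [e1, e2, Nat.factorial_succ (p + r + 1), Nat.factorial_succ p, Nat.factorial_succ r]
    have := Nat.cast_ne_zero (R := ℝ).2 (p + r + 1).factorial_ne_zero
    have h : (p : ℝ) + r + 1 + 1 ≠ 0 := by positivity
    push_cast
    field_simp
    ring

theorem fwdDiff_iter_choose_div_add_one {q r : ℕ} (h : q ≤ r) :
    (fwdDiff 1)^[r] (fun x : ℕ ↦ (x.choose q : ℝ) / ((x : ℝ) + 1)) =
      (-1 : ℝ) ^ q • (fwdDiff 1)^[r] (fun x : ℕ ↦ 1 / ((x : ℝ) + 1)) := by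
  induction q with
  | zero => simp
  | succ q ih =>
    have key : (fun x : ℕ ↦ (x.choose (q + 1) : ℝ) / ((x : ℝ) + 1)) =
        (-1 : ℝ) • (fun x : ℕ ↦ (x.choose q : ℝ) / ((x : ℝ) + 1)) +
          (1 / ((q : ℝ) + 1)) • fun x : ℕ ↦ (x.choose q : ℝ) := by
      ext x
      have h1 : ((x : ℝ) + 1) * x.choose q = (x.choose q + x.choose (q + 1)) * (q + 1) := by
        exact_mod_cast Nat.choose_succ_succ' x q ▸ Nat.add_one_mul_choose_eq x q
      have hx : (x : ℝ) + 1 ≠ 0 := by positivity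
      have hq : (q : ℝ) + 1 ≠ 0 := by positivity
      simp only [Pi.add_apply, Pi.smul_apply, smul_eq_mul]
      field_simp
      linarith
    rw [key, fwdDiff_iter_add, fwdDiff_iter_const_smul, fwdDiff_iter_const_smul,
      fwdDiff_iter_natCast_choose_eq_zero (by omega), ih (by omega), smul_zero, add_zero, smul_smul,
      pow_succ']

theorem sum_neg_one_pow_mul_choose_mul_choose_div (p q : ℕ) :
    ∑ j ∈ range (p + 1), (-1 : ℝ) ^ j * p.choose j *
        ((p + q - j).choose p / (((p + q - j : ℕ) : ℝ) + 1)) =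
      p.factorial * q.factorial / (p + q + 1).factorial := by
  have h := fwdDiff_iter_eq_sum_shift 1
    (fun x : ℕ ↦ (x.choose p : ℝ) / ((x : ℝ) + 1)) p q
  rw [fwdDiff_iter_choose_div_add_one le_rfl, Pi.smul_apply, fwdDiff_iter_one_div_add_one,
    smul_eq_mul, ← mul_assoc, ← mul_pow, neg_one_mul, neg_neg, one_pow, one_mul,
    ← sum_range_reflect] at h
  rw [add_comm p q, h]
  refine sum_congr rfl fun j hj ↦ ?_
  have hj : j ≤ p := by simpa [Nat.lt_succ_iff] using hj
  have e1 : p + 1 - 1 - j = p - j := by omega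
  have e2 : p - (p - j) = j := by omega
  have e3 : q + (p - j) • 1 = q + p - j := by rw [smul_eq_mul]; omega
  rw [e1, e2, e3, Nat.choose_symm hj, zsmul_eq_mul]
  push_cast
  rfl

theorem leibnitz_add_left (p q : ℕ) :
    leibnitz (p + q) p = p.factorial * q.factorial / (p + q + 1).factorial := by
  rw [leibnitz, Nat.cast_add_choose, Nat.factorial_succ]
  push_cast
  have := Nat.cast_ne_zero (R := ℝ).2 (p + q).factorial_ne_zero
  field_simp

theorem choose_mul_choose_mul_choose_mul_factorial (p q j : ℕ) (hj : j ≤ p) :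
    ((p + q).choose q : ℝ) * p.choose j * q.choose j * (j.factorial * (p + q - j).factorial) =
      (p + q).factorial * (p.choose j * (p + q - j).choose p) := by
  rcases le_or_gt j q with hq | hq
  · obtain ⟨d, rfl⟩ := Nat.exists_eq_add_of_le hq
    have e : p + (j + d) - j = p + d := by omega
    rw [e, Nat.cast_add_choose, Nat.cast_add_choose, add_comm p (j + d), Nat.cast_add_choose]
    have h1 := Nat.cast_ne_zero (R := ℝ).2 (j + d).factorial_ne_zero
    field_simp
  · rw [Nat.choose_eq_zero_of_lt hq, Nat.choose_eq_zero_of_lt (by omega : p + q - j < p)]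
    simp

theorem stmt13 (n : ℕ) (t : ℝ) :
    ∑ k ∈ range (n + 1), leibnitz n k * t ^ k =
      (1 / (n.factorial : ℝ)) * ∑ k ∈ range (n + 1), ∑ j ∈ range (n - k + 1),
        (-1) ^ j * (n.choose k : ℝ) * ((n - k).choose j : ℝ) * (k.choose j : ℝ) *
          ((j.factorial : ℝ) * ((n - j).factorial : ℝ) / (((n - j : ℕ) : ℝ) + 1)) *
            t ^ (n - k) := by
  rw [← sum_range_reflect, mul_sum]
  refine sum_congr rfl fun q hq ↦ ?_
  obtain ⟨p, rfl⟩ := Nat.exists_eq_add_of_le' (Nat.lt_succ_iff.1 (mem_range.1 hq))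
  have e1 : p + q + 1 - 1 - q = p := by omega
  have e2 : p + q - q = p := by omega
  rw [e1, e2, leibnitz_add_left, ← sum_neg_one_pow_mul_choose_mul_choose_div, sum_mul, mul_sum]
  refine sum_congr rfl fun j hj ↦ ?_
  have h := choose_mul_choose_mul_choose_mul_factorial p q j (Nat.lt_succ_iff.1 (mem_range.1 hj))
  have hn := Nat.cast_ne_zero (R := ℝ).2 (p + q).factorial_ne_zero
  have hd : ((p + q - j : ℕ) : ℝ) + 1 ≠ 0 := by positivity
  field_simp
  linear_combination (-(t ^ p)) * h
end

section
/- For every real number u with 0 < u < 1, the series ∑_{n=0}^{∞} (∑_{k=0}^{n} l(n,k)) · u^n converges, and its sum equals 2 · log(1-u) / (u^2 - 2u). -/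
open Finset

theorem leibnitz_succ_add_leibnitz_succ {n k : ℕ} (h : k ≤ n) :
    leibnitz (n + 1) k + leibnitz (n + 1) (k + 1) = leibnitz n k := by
  have hc : (0 : ℝ) < n.choose k := by exact_mod_cast Nat.choose_pos h
  have hn : (0 : ℝ) < (n : ℝ) + 1 := by positivity
  have hk : (0 : ℝ) < (k : ℝ) + 1 := by positivity
  have hnk : (0 : ℝ) < (n : ℝ) + 1 - k := by
    have : (k : ℝ) ≤ n := by exact_mod_cast h
    linarith
  have h₁ : ((n + 1).choose k : ℝ) = n.choose k * (n + 1) / (n + 1 - k) := by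
    rw [eq_div_iff hnk.ne']
    have := congrArg (Nat.cast : ℕ → ℝ) (Nat.choose_mul_succ_eq n k)
    rw [Nat.cast_mul, Nat.cast_mul, Nat.cast_sub (by omega)] at this
    push_cast at this
    exact this.symm
  have h₂ : ((n + 1).choose (k + 1) : ℝ) = n.choose k * (n + 1) / (k + 1) := by
    rw [eq_div_iff hk.ne', mul_comm (n.choose k : ℝ)]
    exact_mod_cast (Nat.add_one_mul_choose_eq n k).symm
  unfold leibnitz
  rw [h₁, h₂]
  push_cast
  field_simp
  ring

theorem sum_leibnitz_succ (n : ℕ) :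
    ∑ k ∈ range (n + 2), leibnitz (n + 1) k =
      (∑ k ∈ range (n + 1), leibnitz n k) / 2 + 1 / ((n : ℝ) + 2) := by
  have h : ∑ k ∈ range (n + 1), (leibnitz (n + 1) k + leibnitz (n + 1) (k + 1)) =
      ∑ k ∈ range (n + 1), leibnitz n k :=
    sum_congr rfl fun k hk => leibnitz_succ_add_leibnitz_succ (by simpa [Nat.lt_succ_iff] using hk)
  rw [sum_add_distrib] at h
  have hl := sum_range_succ (leibnitz (n + 1)) (n + 1)
  have hr := sum_range_succ' (leibnitz (n + 1)) (n + 1)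
  have e₀ : leibnitz (n + 1) 0 = 1 / ((n : ℝ) + 2) := by
    simp only [leibnitz, Nat.choose_zero_right]
    push_cast
    ring
  have e₁ : leibnitz (n + 1) (n + 1) = 1 / ((n : ℝ) + 2) := by
    simp only [leibnitz, Nat.choose_self]
    push_cast
    ring
  linarith

theorem sum_leibnitz_mem_Icc (n : ℕ) :
    ∑ k ∈ range (n + 1), leibnitz n k ∈ Set.Icc (0 : ℝ) 1 := by
  induction n with
  | zero => simp [leibnitz]
  | succ n ih =>
    rw [sum_leibnitz_succ]
    have h₀ : (0 : ℝ) ≤ 1 / ((n : ℝ) + 2) := by positivity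
    have h₁ : 1 / ((n : ℝ) + 2) ≤ 1 / 2 :=
      one_div_le_one_div_of_le (by norm_num) (by linarith [n.cast_nonneg (α := ℝ)])
    constructor <;> linarith [ih.1, ih.2]

theorem stmt15 (u : ℝ) (hu0 : 0 < u) (hu1 : u < 1) :
    HasSum (fun n : ℕ => (∑ k ∈ range (n + 1), leibnitz n k) * u ^ n)
      (2 * Real.log (1 - u) / (u ^ 2 - 2 * u)) := by
  have hs : Summable fun n : ℕ => (∑ k ∈ range (n + 1), leibnitz n k) * u ^ n :=
    Summable.of_nonneg_of_le
      (fun n => mul_nonneg (sum_leibnitz_mem_Icc n).1 (by positivity))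
      (fun n => mul_le_of_le_one_left (by positivity) (sum_leibnitz_mem_Icc n).2)
      (summable_geometric_of_lt_one hu0.le hu1)
  obtain ⟨F, hF⟩ := hs
  have hlog := Real.hasSum_pow_div_log_of_abs_lt_one (abs_lt.2 ⟨by linarith, hu1⟩)
  have htail := ((hasSum_nat_add_iff' 1).2 hlog).div_const u
  have hrec := (hF.mul_left (u / 2)).add htail
  have hshift := (hasSum_nat_add_iff' 1).2 hF
  have key := hshift.unique (hrec.congr_fun fun n => by
    rw [sum_leibnitz_succ]
    push_cast
    field_simp
    ring)
  simp only [sum_range_one, leibnitz] at key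
  norm_num at key
  have hd : u ^ 2 - 2 * u ≠ 0 := by nlinarith
  convert hF using 1
  rw [div_eq_iff hd]
  field_simp at key
  linarith
end
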